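/- Fix real constants τ > 1, κ > 0 and C₀ > 0. There exists a constant C > 0, depending only on τ, κ and C₀, such that for every integer j ≥ 2, every symmetric matrix Γ ∈ ℝ^{j×j} with λ_min(Γ) ≥ κ and |Γ_{k,l}| ≤ C₀(|k−l| + 1)^{−τ} for all 1 ≤ k, l ≤ j, and every vector ν ∈ ℝ^j with |ν_k| ≤ C₀ k^{−τ} for 1 ≤ k ≤ j, the last coordinate of Γ⁻¹ν satisfies |(Γ⁻¹ν)_j| ≤ C((log j + 1)/j)^{τ−1}. -/

import Mathlib

open MeasureTheory Matrix Finset in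
/-- Euclidean (ℓ²) norm on `Fin j → ℝ`. -/
noncomputable def euclNorm {j : ℕ} (v : Fin j → ℝ) : ℝ := Real.sqrt (∑ k, (v k) ^ 2)

open Matrix in
/-- `quadLB A κ` : the quadratic form of `A` is bounded below by `κ·|v|²`.
For a symmetric matrix this says exactly that the smallest eigenvalue is at least `κ`. -/
def quadLB {j : ℕ} (A : Matrix (Fin j) (Fin j) ℝ) (κ : ℝ) : Prop :=
  ∀ v : Fin j → ℝ, κ * (∑ k, (v k) ^ 2) ≤ v ⬝ᵥ (A *ᵥ v)

/-- ℓ²→ℓ² operator norm of a square real matrix. -/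
noncomputable def opNorm {j : ℕ} (A : Matrix (Fin j) (Fin j) ℝ) : ℝ :=
  ‖(Matrix.toEuclideanCLM (𝕜 := ℝ) A : EuclideanSpace ℝ (Fin j) →L[ℝ] EuclideanSpace ℝ (Fin j))‖

/-- `Γ_j(t)` built from a local autocovariance function `γ`:
its `(k,l)` entry (1-based) is `γ t |k-l|`. -/
def gammaMat (γ : ℝ → ℕ → ℝ) (t : ℝ) (j : ℕ) : Matrix (Fin j) (Fin j) ℝ :=
  Matrix.of fun k l : Fin j => γ t ((k.1 : ℤ) - (l.1 : ℤ)).natAbs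

/-- `ν_j(t)` built from a local autocovariance function `γ`: its `k`-th entry (1-based)
is `γ t k`. -/
def gammaVec (γ : ℝ → ℕ → ℝ) (t : ℝ) (j : ℕ) : Fin j → ℝ := fun k => γ t (k.1 + 1)

/-- Banded truncation of a matrix at bandwidth `b`: keeps the entries with `|k-l| ≤ b`
and sets all others to zero. -/
def bandTrunc {j : ℕ} (A : Matrix (Fin j) (Fin j) ℝ) (b : ℕ) : Matrix (Fin j) (Fin j) ℝ :=
  Matrix.of fun k l : Fin j => if ((k.1 : ℤ) - (l.1 : ℤ)).natAbs ≤ b then A k l else 0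

lemma sq_euclNorm {j : ℕ} (v : Fin j → ℝ) : euclNorm v ^ 2 = ∑ k, v k ^ 2 :=
  Real.sq_sqrt (Finset.sum_nonneg fun _ _ => sq_nonneg _)

lemma euclNorm_nonneg {j : ℕ} (v : Fin j → ℝ) : 0 ≤ euclNorm v := Real.sqrt_nonneg _

lemma abs_le_euclNorm {j : ℕ} (v : Fin j → ℝ) (k : Fin j) : |v k| ≤ euclNorm v :=
  Real.abs_le_sqrt
    (Finset.single_le_sum (f := fun k => v k ^ 2) (fun _ _ => sq_nonneg _) (Finset.mem_univ k))

lemma sum_mul_le_euclNorm_mul {j : ℕ} (u v : Fin j → ℝ) :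
    ∑ k, u k * v k ≤ euclNorm u * euclNorm v := by
  refine le_of_sq_le_sq ?_ (mul_nonneg (euclNorm_nonneg u) (euclNorm_nonneg v))
  rw [mul_pow, sq_euclNorm, sq_euclNorm]
  exact Finset.sum_mul_sq_le_sq_mul_sq _ _ _

/-- Schur test for a nonnegative kernel, in bilinear form. -/
lemma schur_test {j : ℕ} {G : Fin j → Fin j → ℝ} {M : ℝ} (hG : ∀ k l, 0 ≤ G k l) (hM : 0 ≤ M)
    (hrow : ∀ k, ∑ l, G k l ≤ M) (hcol : ∀ l, ∑ k, G k l ≤ M) (u v : Fin j → ℝ) :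
    ∑ k, ∑ l, |u k| * G k l * |v l| ≤ M * (euclNorm u * euclNorm v) := by
  have hu : ∑ p : Fin j × Fin j, G p.1 p.2 * u p.1 ^ 2 ≤ M * euclNorm u ^ 2 := by
    rw [Fintype.sum_prod_type, sq_euclNorm, Finset.mul_sum]
    refine Finset.sum_le_sum fun k _ => ?_
    dsimp only
    rw [← Finset.sum_mul]
    exact mul_le_mul_of_nonneg_right (hrow k) (sq_nonneg _)
  have hv : ∑ p : Fin j × Fin j, G p.1 p.2 * v p.2 ^ 2 ≤ M * euclNorm v ^ 2 := by
    rw [Fintype.sum_prod_type_right, sq_euclNorm, Finset.mul_sum]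
    refine Finset.sum_le_sum fun l _ => ?_
    dsimp only
    rw [← Finset.sum_mul]
    exact mul_le_mul_of_nonneg_right (hcol l) (sq_nonneg _)
  have hcs := Finset.sum_sq_le_sum_mul_sum_of_sq_le_mul (Finset.univ : Finset (Fin j × Fin j))
    (r := fun p => |u p.1| * G p.1 p.2 * |v p.2|)
    (f := fun p => G p.1 p.2 * u p.1 ^ 2) (g := fun p => G p.1 p.2 * v p.2 ^ 2)
    (fun p _ => mul_nonneg (hG _ _) (sq_nonneg _)) (fun p _ => mul_nonneg (hG _ _) (sq_nonneg _))
    (fun p _ => by rw [mul_pow, mul_pow, sq_abs, sq_abs]; apply le_of_eq; ring)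
  rw [← Fintype.sum_prod_type (fun p : Fin j × Fin j => |u p.1| * G p.1 p.2 * |v p.2|)]
  have hu0 := euclNorm_nonneg u
  have hv0 := euclNorm_nonneg v
  refine le_of_sq_le_sq (hcs.trans ?_) (by positivity)
  calc _ ≤ (M * euclNorm u ^ 2) * (M * euclNorm v ^ 2) :=
        mul_le_mul hu hv (Finset.sum_nonneg fun p _ => mul_nonneg (hG _ _) (sq_nonneg _))
          (by positivity)
    _ = _ := by ring

/-- Weighted energy estimate: if the commutator of `A` with the diagonal weight `w` is dominated
by a kernel `G` acting on the weighted solution plus a kernel `H` acting on the solution itself,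
then the weighted solution is controlled by the weighted data and the solution. -/
lemma weighted_energy_bound {j : ℕ} {A : Matrix (Fin j) (Fin j) ℝ} {κ g h : ℝ}
    (hA : quadLB A κ) {x w : Fin j → ℝ} (hw : ∀ k, 0 ≤ w k) {G H : Fin j → Fin j → ℝ}
    (hg : 0 ≤ g) (hh : 0 ≤ h) (hG : ∀ k l, 0 ≤ G k l) (hH : ∀ k l, 0 ≤ H k l)
    (hGr : ∀ k, ∑ l, G k l ≤ g) (hGc : ∀ l, ∑ k, G k l ≤ g)
    (hHr : ∀ k, ∑ l, H k l ≤ h) (hHc : ∀ l, ∑ k, H k l ≤ h)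
    (hcomm : ∀ k l, |A k l| * |w k - w l| ≤ G k l * w l + H k l) :
    κ * euclNorm (w * x) ≤
      euclNorm (w * A.mulVec x) + g * euclNorm (w * x) + h * euclNorm x := by
  have hz0 := euclNorm_nonneg (w * x)
  have hf0 := euclNorm_nonneg (w * A.mulVec x)
  have hx0 := euclNorm_nonneg x
  rcases hz0.eq_or_lt with hz | hz
  · rw [← hz]
    nlinarith [mul_nonneg hh hx0]
  refine le_of_mul_le_mul_left ?_ hz
  have h1 := hA (w * x)
  rw [← sq_euclNorm] at h1
  have h2 : (w * x) ⬝ᵥ (A.mulVec (w * x)) = ∑ k, (w * x) k * (w * A.mulVec x) k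
      - ∑ k, ∑ l, (w * x) k * (A k l * (w k - w l) * x l) := by
    rw [← Finset.sum_sub_distrib]
    refine Finset.sum_congr rfl fun k _ => ?_
    simp only [Matrix.mulVec, dotProduct, Pi.mul_apply, Finset.mul_sum]
    rw [← Finset.sum_sub_distrib]
    exact Finset.sum_congr rfl fun l _ => by ring
  have h3 : -∑ k, ∑ l, (w * x) k * (A k l * (w k - w l) * x l) ≤
      ∑ k, ∑ l, |(w * x) k| * G k l * |(w * x) l| + ∑ k, ∑ l, |(w * x) k| * H k l * |x l| := by
    rw [← Finset.sum_neg_distrib, ← Finset.sum_add_distrib]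
    refine Finset.sum_le_sum fun k _ => ?_
    rw [← Finset.sum_neg_distrib, ← Finset.sum_add_distrib]
    refine Finset.sum_le_sum fun l _ => ?_
    calc _ ≤ |(w * x) k * (A k l * (w k - w l) * x l)| := neg_le_abs _
      _ = |(w * x) k| * (|A k l| * |w k - w l|) * |x l| := by simp only [abs_mul]; ring
      _ ≤ |(w * x) k| * (G k l * w l + H k l) * |x l| := by gcongr; exact hcomm k l
      _ = _ := by
        rw [Pi.mul_apply w x l, abs_mul, abs_of_nonneg (hw l)]; ring
  have h4 := sum_mul_le_euclNorm_mul (w * x) (w * A.mulVec x)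
  have h5 := schur_test hG hg hGr hGc (w * x) (w * x)
  have h6 := schur_test hH hh hHr hHc (w * x) x
  linarith

lemma mul_euclNorm_le_of_quadLB {j : ℕ} {A : Matrix (Fin j) (Fin j) ℝ} {κ : ℝ}
    (hA : quadLB A κ) (x : Fin j → ℝ) : κ * euclNorm x ≤ euclNorm (A.mulVec x) := by
  have := weighted_energy_bound hA (x := x) (w := 1) (G := 0) (H := 0) (g := 0) (h := 0)
  simpa using this

lemma mulVec_inv_mulVec_of_quadLB {j : ℕ} {A : Matrix (Fin j) (Fin j) ℝ} {κ : ℝ} (hκ : 0 < κ)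
    (hA : quadLB A κ) (f : Fin j → ℝ) : A.mulVec (A⁻¹.mulVec f) = f := by
  have hinj : Function.Injective A.mulVec := by
    intro u v huv
    have h0 : euclNorm (u - v) ≤ 0 := by
      have := mul_euclNorm_le_of_quadLB hA (u - v)
      rw [Matrix.mulVec_sub, huv, sub_self] at this
      simp only [euclNorm, Pi.zero_apply, ne_eq, OfNat.ofNat_ne_zero, not_false_eq_true, zero_pow,
        Finset.sum_const_zero, Real.sqrt_zero] at this ⊢
      exact nonpos_of_mul_nonpos_right this hκ
    ext k
    have := abs_nonpos_iff.1 ((abs_le_euclNorm (u - v) k).trans h0)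
    exact sub_eq_zero.1 this
  have hdet := (Matrix.isUnit_iff_isUnit_det A).1 (Matrix.mulVec_injective_iff_isUnit.1 hinj)
  rw [Matrix.mulVec_mulVec, Matrix.mul_nonsing_inv A hdet, Matrix.one_mulVec]

lemma sum_fin_natAbs_sub_row_le {f : ℕ → ℝ} (hf : ∀ m, 0 ≤ f m) {j : ℕ} (k : Fin j) :
    ∑ l : Fin j, f ((k.1 : ℤ) - (l.1 : ℤ)).natAbs ≤ 2 * ∑ m ∈ Finset.range j, f m := by
  have hk := k.2
  rw [Fin.sum_univ_eq_sum_range (fun l => f ((k.1 : ℤ) - (l : ℤ)).natAbs), two_mul]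
  have hj : j = (k.1 + 1) + (j - (k.1 + 1)) := by omega
  have hsplit := Finset.sum_range_add (fun l => f ((k.1 : ℤ) - (l : ℤ)).natAbs)
    (k.1 + 1) (j - (k.1 + 1))
  rw [← hj] at hsplit
  rw [hsplit]
  refine add_le_add ?_ ?_
  · calc _ = ∑ l ∈ Finset.range (k.1 + 1), f (k.1 + 1 - 1 - l) := by
          refine Finset.sum_congr rfl fun l hl => ?_
          rw [Finset.mem_range] at hl
          congr 1
          omega
      _ = ∑ m ∈ Finset.range (k.1 + 1), f m := Finset.sum_range_reflect f _
      _ ≤ _ := Finset.sum_le_sum_of_subset_of_nonneg (Finset.range_mono hk) fun _ _ _ => hf _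
  · calc _ = ∑ l ∈ Finset.range (j - (k.1 + 1)), f (l + 1) := by
          refine Finset.sum_congr rfl fun l hl => ?_
          congr 1
          omega
      _ ≤ ∑ m ∈ Finset.range (j - (k.1 + 1) + 1), f m := by
          rw [Finset.sum_range_succ']
          exact le_add_of_nonneg_right (hf 0)
      _ ≤ _ := Finset.sum_le_sum_of_subset_of_nonneg (Finset.range_mono (by omega)) fun _ _ _ => hf _

lemma mul_rpow_add_one_le_sub {s x : ℝ} (hs : 0 < s) (hx : 0 < x) :
    s * (x + 1) ^ (-(s + 1)) ≤ x ^ (-s) - (x + 1) ^ (-s) := by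
  have hx1 : 0 < x + 1 := by linarith
  have hlog : (x + 1)⁻¹ ≤ Real.log ((x + 1) / x) := by
    refine le_trans (le_of_eq ?_) (Real.one_sub_inv_le_log_of_pos (div_pos hx1 hx))
    field_simp
    ring
  have hratio : 1 + s * (x + 1)⁻¹ ≤ ((x + 1) / x) ^ s := by
    rw [Real.rpow_def_of_pos (div_pos hx1 hx)]
    nlinarith [Real.add_one_le_exp (Real.log ((x + 1) / x) * s)]
  have h1 : x ^ (-s) = (x + 1) ^ (-s) * ((x + 1) / x) ^ s := by
    rw [Real.div_rpow hx1.le hx.le, Real.rpow_neg hx1.le, Real.rpow_neg hx.le]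
    have := (Real.rpow_pos_of_pos hx1 s).ne'
    field_simp
  have h2 : (x + 1) ^ (-(s + 1)) = (x + 1) ^ (-s) * (x + 1)⁻¹ := by
    rw [neg_add, Real.rpow_add hx1, Real.rpow_neg_one]
  rw [h1, h2]
  nlinarith [Real.rpow_pos_of_pos hx1 (-s)]

/-- Tail bound for the series `∑ (m + 1) ^ (-τ)`. -/
lemma sum_range_tail_le {τ b : ℝ} (hτ : 1 < τ) (hb : 0 < b) (n : ℕ) :
    ∑ m ∈ Finset.range n, (if (m : ℝ) ≤ b then 0 else ((m : ℝ) + 1) ^ (-τ)) ≤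
      b ^ (-(τ - 1)) / (τ - 1) := by
  have hs : 0 < τ - 1 := by linarith
  suffices h : ∑ m ∈ Finset.range n, (if (m : ℝ) ≤ b then 0 else ((m : ℝ) + 1) ^ (-τ)) ≤
      (b ^ (-(τ - 1)) - (max (n : ℝ) b) ^ (-(τ - 1))) / (τ - 1) by
    refine h.trans ?_
    gcongr
    exact sub_le_self _ (by positivity)
  induction n with
  | zero => simp [hb.le]
  | succ n ih =>
    rw [Finset.sum_range_succ]
    push_cast
    split_ifs with hn
    · rw [add_zero]
      refine ih.trans ?_
      gcongr ?_ / _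
      refine sub_le_sub_left (Real.rpow_le_rpow_of_nonpos (by positivity) ?_ (by linarith)) _
      exact max_le_max_right _ (by linarith)
    · push Not at hn
      have h1 := mul_rpow_add_one_le_sub hs (hb.trans hn)
      rw [max_eq_left hn.le] at ih
      rw [max_eq_left (by linarith)]
      rw [sub_add_cancel] at h1
      rw [le_div_iff₀ hs] at ih ⊢
      linarith

lemma summable_nat_add_one_rpow_neg {τ : ℝ} (hτ : 1 < τ) :
    Summable fun m : ℕ => ((m : ℝ) + 1) ^ (-τ) := by
  have := (summable_nat_add_iff 1).2 (Real.summable_nat_rpow.2 (neg_lt_neg hτ))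
  simpa using this

lemma add_one_rpow_neg_nonneg (τ : ℝ) (m : ℕ) : 0 ≤ ((m : ℝ) + 1) ^ (-τ) := by positivity

lemma sq_add_one_rpow_neg_le {τ : ℝ} (hτ : 1 < τ) (m : ℕ) :
    (((m : ℝ) + 1) ^ (-τ)) ^ 2 ≤ ((m : ℝ) + 1) ^ (-τ) := by
  have h1 : ((m : ℝ) + 1) ^ (-τ) ≤ 1 :=
    Real.rpow_le_one_of_one_le_of_nonpos (by simp) (by linarith)
  nlinarith [add_one_rpow_neg_nonneg τ m]

lemma sum_fin_natAbs_sub_col_le {f : ℕ → ℝ} (hf : ∀ m, 0 ≤ f m) {j : ℕ} (l : Fin j) :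
    ∑ k : Fin j, f ((k.1 : ℤ) - (l.1 : ℤ)).natAbs ≤ 2 * ∑ m ∈ Finset.range j, f m := by
  refine le_trans (le_of_eq (Finset.sum_congr rfl fun k _ => ?_)) (sum_fin_natAbs_sub_row_le hf l)
  rw [← Int.natAbs_neg, neg_sub]

lemma abs_exp_sub_one_le_exp_abs_sub_one (t : ℝ) : |Real.exp t - 1| ≤ Real.exp |t| - 1 := by
  rcases le_total 0 t with ht | ht
  · rw [abs_of_nonneg ht, abs_of_nonneg (by linarith [Real.one_le_exp ht])]
  · rw [abs_of_nonpos ht, abs_of_nonpos (by linarith [Real.exp_le_one_iff.2 ht])]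
    linarith [Real.add_one_le_exp t, Real.add_one_le_exp (-t)]

/-- Exponential weight on `Fin j` with rate `a`, equal to `1` at the last index. -/
noncomputable def expWeight (a : ℝ) (j : ℕ) : Fin j → ℝ :=
  fun k => Real.exp (-(a * ((j : ℝ) - 1 - k.1)))

lemma expWeight_pos (a : ℝ) {j : ℕ} (k : Fin j) : 0 < expWeight a j k := Real.exp_pos _

lemma expWeight_le_one {a : ℝ} (ha : 0 ≤ a) {j : ℕ} (k : Fin j) : expWeight a j k ≤ 1 := by
  have hk : (k.1 : ℝ) + 1 ≤ j := by exact_mod_cast k.2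
  exact Real.exp_le_one_iff.2 (neg_nonpos.2 (mul_nonneg ha (by linarith)))

lemma abs_expWeight_sub_le {a δ : ℝ} (ha : 0 < a) (hδ : 0 < δ) {j : ℕ} {k l : Fin j}
    (hkl : |(k.1 : ℝ) - l.1| ≤ Real.log (1 + δ) / a) :
    |expWeight a j k - expWeight a j l| ≤ δ * expWeight a j l := by
  have hw : expWeight a j k = expWeight a j l * Real.exp (a * ((k.1 : ℝ) - l.1)) := by
    rw [expWeight, expWeight, ← Real.exp_add]
    ring_nf
  have hexp : Real.exp |a * ((k.1 : ℝ) - l.1)| ≤ 1 + δ := by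
    rw [abs_mul, abs_of_pos ha, ← Real.le_log_iff_exp_le (by linarith), mul_comm]
    exact (le_div_iff₀ ha).1 hkl
  calc |expWeight a j k - expWeight a j l|
      = expWeight a j l * |Real.exp (a * ((k.1 : ℝ) - l.1)) - 1| := by
        rw [hw, ← mul_sub_one, abs_mul, abs_of_pos (expWeight_pos a l)]
    _ ≤ expWeight a j l * δ := by
        refine mul_le_mul_of_nonneg_left ?_ (expWeight_pos a l).le
        linarith [abs_exp_sub_one_le_exp_abs_sub_one (a * ((k.1 : ℝ) - l.1))]
    _ = _ := mul_comm _ _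

lemma abs_expWeight_sub_le_one {a : ℝ} (ha : 0 ≤ a) {j : ℕ} (k l : Fin j) :
    |expWeight a j k - expWeight a j l| ≤ 1 := by
  rw [abs_le]
  constructor <;> linarith [expWeight_pos a k, expWeight_le_one ha k, expWeight_pos a l,
    expWeight_le_one ha l]

/-- Weighted energy estimate for a matrix with polynomially decaying entries. -/
lemma expWeight_energy_bound {τ κ C₀ a δ : ℝ} (hτ : 1 < τ) (hC₀ : 0 < C₀) (ha : 0 < a)
    (hδ : 0 < δ) {j : ℕ} {A : Matrix (Fin j) (Fin j) ℝ} (hA : quadLB A κ)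
    (hdec : ∀ k l : Fin j, |A k l| ≤ C₀ * (|(k.1 : ℝ) - (l.1 : ℝ)| + 1) ^ (-τ))
    (x : Fin j → ℝ) :
    κ * euclNorm (expWeight a j * x) ≤ euclNorm (expWeight a j * A.mulVec x)
      + 2 * (δ * C₀ * ∑' m : ℕ, ((m : ℝ) + 1) ^ (-τ)) * euclNorm (expWeight a j * x)
      + 2 * (C₀ * ((Real.log (1 + δ) / a) ^ (-(τ - 1)) / (τ - 1))) * euclNorm x := by
  set b := Real.log (1 + δ) / a with hb_def
  have hb : 0 < b := div_pos (Real.log_pos (by linarith)) ha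
  have hS0 : 0 ≤ ∑' m : ℕ, ((m : ℝ) + 1) ^ (-τ) := tsum_nonneg (add_one_rpow_neg_nonneg τ)
  have hτ' : 0 < τ - 1 := by linarith
  let f : ℕ → ℝ := fun m => δ * C₀ * ((m : ℝ) + 1) ^ (-τ)
  let h : ℕ → ℝ := fun m => C₀ * if (m : ℝ) ≤ b then 0 else ((m : ℝ) + 1) ^ (-τ)
  have hf : ∀ m, 0 ≤ f m := fun m => by positivity
  have hh : ∀ m, 0 ≤ h m := fun m => by
    refine mul_nonneg hC₀.le ?_
    split_ifs
    · exact le_rfl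
    · positivity
  have hfsum : 2 * ∑ m ∈ Finset.range j, f m ≤
      2 * (δ * C₀ * ∑' m : ℕ, ((m : ℝ) + 1) ^ (-τ)) := by
    rw [← Finset.mul_sum]
    gcongr
    exact (summable_nat_add_one_rpow_neg hτ).sum_le_tsum _ fun m _ => add_one_rpow_neg_nonneg τ m
  have hhsum : 2 * ∑ m ∈ Finset.range j, h m ≤ 2 * (C₀ * (b ^ (-(τ - 1)) / (τ - 1))) := by
    rw [← Finset.mul_sum]
    gcongr
    exact sum_range_tail_le hτ hb j
  refine weighted_energy_bound hA (fun k => (expWeight_pos a k).le)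
    (G := fun k l => f ((k.1 : ℤ) - (l.1 : ℤ)).natAbs)
    (H := fun k l => h ((k.1 : ℤ) - (l.1 : ℤ)).natAbs) (by positivity) (by positivity)
    (fun _ _ => hf _) (fun _ _ => hh _)
    (fun k => (sum_fin_natAbs_sub_row_le hf k).trans hfsum)
    (fun l => (sum_fin_natAbs_sub_col_le hf l).trans hfsum)
    (fun k => (sum_fin_natAbs_sub_row_le hh k).trans hhsum)
    (fun l => (sum_fin_natAbs_sub_col_le hh l).trans hhsum) fun k l => ?_
  have hcast : ((((k.1 : ℤ) - (l.1 : ℤ)).natAbs : ℕ) : ℝ) = |(k.1 : ℝ) - l.1| := by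
    rw [Nat.cast_natAbs]
    push_cast
    rfl
  simp only [f, h, hcast]
  have hp : 0 ≤ (|(k.1 : ℝ) - l.1| + 1) ^ (-τ) := by positivity
  split_ifs with hkl
  · calc _ ≤ (C₀ * (|(k.1 : ℝ) - l.1| + 1) ^ (-τ)) * (δ * expWeight a j l) :=
          mul_le_mul (hdec k l) (abs_expWeight_sub_le ha hδ hkl) (abs_nonneg _) (by positivity)
      _ = _ := by ring
  · have hw := (expWeight_pos a l).le
    calc _ ≤ (C₀ * (|(k.1 : ℝ) - l.1| + 1) ^ (-τ)) * 1 :=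
          mul_le_mul (hdec k l) (abs_expWeight_sub_le_one ha.le k l) (abs_nonneg _)
            (by positivity)
      _ ≤ _ := by
          rw [mul_one]
          exact le_add_of_nonneg_left (by positivity)

lemma euclNorm_le_of_decay {τ C₀ : ℝ} (hτ : 1 < τ) (hC₀ : 0 < C₀) {j : ℕ} {ν : Fin j → ℝ}
    (hν : ∀ k : Fin j, |ν k| ≤ C₀ * ((k.1 : ℝ) + 1) ^ (-τ)) :
    euclNorm ν ≤ C₀ * √(∑' m : ℕ, ((m : ℝ) + 1) ^ (-τ)) := by
  have hS0 : 0 ≤ ∑' m : ℕ, ((m : ℝ) + 1) ^ (-τ) := tsum_nonneg (add_one_rpow_neg_nonneg τ)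
  refine le_of_sq_le_sq ?_ (by positivity)
  rw [sq_euclNorm, mul_pow, Real.sq_sqrt hS0]
  calc ∑ k, ν k ^ 2 ≤ ∑ k : Fin j, C₀ ^ 2 * ((k.1 : ℝ) + 1) ^ (-τ) := by
        refine Finset.sum_le_sum fun k _ => ?_
        rw [← sq_abs]
        calc _ ≤ (C₀ * ((k.1 : ℝ) + 1) ^ (-τ)) ^ 2 := by gcongr; exact hν k
          _ ≤ _ := by
            rw [mul_pow]
            gcongr
            exact sq_add_one_rpow_neg_le hτ k
    _ = C₀ ^ 2 * ∑ m ∈ Finset.range j, ((m : ℝ) + 1) ^ (-τ) := by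
        rw [← Finset.mul_sum, Fin.sum_univ_eq_sum_range (fun m => ((m : ℝ) + 1) ^ (-τ))]
    _ ≤ _ := by
        gcongr
        exact (summable_nat_add_one_rpow_neg hτ).sum_le_tsum _ fun m _ => add_one_rpow_neg_nonneg τ m

lemma euclNorm_expWeight_mul_le {τ C₀ a : ℝ} (hτ : 1 < τ) (hC₀ : 0 < C₀) {j : ℕ} (hj : 0 < j)
    (ha : 0 ≤ a) (haj : 2 * (τ - 1) * Real.log j ≤ a * j) {ν : Fin j → ℝ}
    (hν : ∀ k : Fin j, |ν k| ≤ C₀ * ((k.1 : ℝ) + 1) ^ (-τ)) :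
    euclNorm (expWeight a j * ν) ≤
      C₀ * √(∑' m : ℕ, ((m : ℝ) + 1) ^ (-τ) + 4 ^ τ) * (j : ℝ) ^ (-(τ - 1)) := by
  have hS0 : 0 ≤ ∑' m : ℕ, ((m : ℝ) + 1) ^ (-τ) := tsum_nonneg (add_one_rpow_neg_nonneg τ)
  have hj0 : (0 : ℝ) < j := by exact_mod_cast hj
  have hj1 : (1 : ℝ) ≤ j := by exact_mod_cast hj
  set Q := ((j : ℝ) ^ (-(τ - 1))) ^ 2 with hQ
  have hQexp : Q = Real.exp (-(2 * (τ - 1) * Real.log j)) := by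
    rw [hQ, Real.rpow_def_of_pos hj0, ← Real.exp_nat_mul]
    push_cast
    ring_nf
  have hhalf : (((j : ℝ) / 2) ^ (-τ)) ^ 2 ≤ 4 ^ τ * (Q / j) := by
    have h4 : (4 : ℝ) ^ τ = ((2 : ℝ) ^ τ) ^ 2 := by
      rw [show (4 : ℝ) = 2 * 2 by norm_num, Real.mul_rpow (by norm_num) (by norm_num), sq]
    have hsplit : (j : ℝ) ^ (-τ) = (j : ℝ) ^ (-(τ - 1)) * (j : ℝ)⁻¹ := by
      rw [← Real.rpow_neg_one, ← Real.rpow_add hj0]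
      ring_nf
    rw [Real.div_rpow hj0.le (by norm_num), Real.rpow_neg (by norm_num : (0 : ℝ) ≤ 2), hsplit,
      div_inv_eq_mul, h4, mul_pow, mul_pow, ← hQ]
    have hinv : ((j : ℝ)⁻¹) ^ 2 ≤ (j : ℝ)⁻¹ :=
      pow_le_of_le_one (by positivity) (inv_le_one_of_one_le₀ hj1) (by norm_num)
    calc _ = ((2 : ℝ) ^ τ) ^ 2 * Q * ((j : ℝ)⁻¹) ^ 2 := by ring
      _ ≤ ((2 : ℝ) ^ τ) ^ 2 * Q * (j : ℝ)⁻¹ := by gcongr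
      _ = _ := by rw [div_eq_mul_inv]; ring
  have hterm : ∀ k : Fin j, (expWeight a j * ν) k ^ 2 ≤
      C₀ ^ 2 * Q * (((k.1 : ℝ) + 1) ^ (-τ) + 4 ^ τ / j) := by
    intro k
    have hp := add_one_rpow_neg_nonneg τ k.1
    have hνk : ν k ^ 2 ≤ C₀ ^ 2 * (((k.1 : ℝ) + 1) ^ (-τ)) ^ 2 := by
      rw [← sq_abs, ← mul_pow]
      gcongr
      exact hν k
    rw [Pi.mul_apply, mul_pow]
    rcases le_or_gt ((k.1 : ℝ) + 1) (j / 2) with hk | hk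
    · have hw : expWeight a j k ^ 2 ≤ Q := by
        rw [hQexp, expWeight, ← Real.exp_nat_mul, Real.exp_le_exp]
        push_cast
        nlinarith
      calc _ ≤ Q * (C₀ ^ 2 * (((k.1 : ℝ) + 1) ^ (-τ)) ^ 2) := by gcongr
        _ ≤ Q * (C₀ ^ 2 * ((k.1 : ℝ) + 1) ^ (-τ)) := by
          gcongr
          exact sq_add_one_rpow_neg_le hτ k
        _ = C₀ ^ 2 * Q * (((k.1 : ℝ) + 1) ^ (-τ)) := by ring
        _ ≤ _ := by
          gcongr
          exact le_add_of_nonneg_right (by positivity)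
    · have hw : expWeight a j k ^ 2 ≤ 1 :=
        pow_le_one₀ (expWeight_pos a k).le (expWeight_le_one ha k)
      calc _ ≤ 1 * (C₀ ^ 2 * (((k.1 : ℝ) + 1) ^ (-τ)) ^ 2) := by gcongr
        _ ≤ 1 * (C₀ ^ 2 * (((j : ℝ) / 2) ^ (-τ)) ^ 2) := by
          gcongr 1 * (C₀ ^ 2 * ?_ ^ 2)
          exact Real.rpow_le_rpow_of_nonpos (by positivity) hk.le (by linarith)
        _ ≤ 1 * (C₀ ^ 2 * (4 ^ τ * (Q / j))) := by gcongr
        _ = C₀ ^ 2 * Q * (4 ^ τ / j) := by ring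
        _ ≤ _ := by
          gcongr
          exact le_add_of_nonneg_left hp
  refine le_of_sq_le_sq ?_ (by positivity)
  rw [sq_euclNorm, mul_pow, mul_pow, Real.sq_sqrt (by positivity), ← hQ]
  calc _ ≤ ∑ k : Fin j, C₀ ^ 2 * Q * (((k.1 : ℝ) + 1) ^ (-τ) + 4 ^ τ / j) :=
        Finset.sum_le_sum fun k _ => hterm k
    _ = C₀ ^ 2 * Q * (∑ m ∈ Finset.range j, ((m : ℝ) + 1) ^ (-τ) + 4 ^ τ) := by
        rw [← Finset.mul_sum, Finset.sum_add_distrib,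
          Fin.sum_univ_eq_sum_range (fun m => ((m : ℝ) + 1) ^ (-τ)), Finset.sum_const,
          Finset.card_univ, Fintype.card_fin, nsmul_eq_mul, mul_div_cancel₀ _ hj0.ne']
    _ ≤ C₀ ^ 2 * Q * (∑' m : ℕ, ((m : ℝ) + 1) ^ (-τ) + 4 ^ τ) := by
        gcongr
        exact (summable_nat_add_one_rpow_neg hτ).sum_le_tsum _ fun m _ => add_one_rpow_neg_nonneg τ m
    _ = _ := by ring

open Matrix Real in
/-- deterministic matrix core of the PACF decay bound: for a symmetric matrix
with polynomially decaying entries and smallest eigenvalue at least `κ`, the last coordinate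
of `Γ⁻¹ν` decays like `((log j + 1)/j)^(τ-1)`. -/
theorem pacf_decay_matrix (τ κ C₀ : ℝ) (hτ : 1 < τ) (hκ : 0 < κ) (hC₀ : 0 < C₀) :
    ∃ C : ℝ, 0 < C ∧
      ∀ (j : ℕ) (hj : 2 ≤ j) (Γ : Matrix (Fin j) (Fin j) ℝ) (ν : Fin j → ℝ)
        (_hsym : Γ.IsSymm) (_hmin : quadLB Γ κ)
        (_hΓ : ∀ k l : Fin j, |Γ k l| ≤ C₀ * (|(k.1 : ℝ) - (l.1 : ℝ)| + 1) ^ (-τ))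
        (_hν : ∀ k : Fin j, |ν k| ≤ C₀ * ((k.1 : ℝ) + 1) ^ (-τ)),
        |(Γ⁻¹ *ᵥ ν) ⟨j - 1, by omega⟩| ≤ C * ((Real.log j + 1) / j) ^ (τ - 1) := by
  set S := ∑' m : ℕ, ((m : ℝ) + 1) ^ (-τ) with hS
  have hSpos : 0 < S :=
    (summable_nat_add_one_rpow_neg hτ).tsum_pos (add_one_rpow_neg_nonneg τ) 0 (by simp)
  have hτ' : 0 < τ - 1 := by linarith
  set δ := κ / (4 * C₀ * S) with hδ_def
  have hδ : 0 < δ := by positivity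
  have hδS : 2 * (δ * C₀ * S) = κ / 2 := by
    rw [hδ_def]
    field_simp
    norm_num
  have hε : 0 < Real.log (1 + δ) := Real.log_pos (by linarith)
  set ε := Real.log (1 + δ) with hε_def
  set c := (2 * (τ - 1) / ε) ^ (τ - 1) with hc
  have hcpos : 0 < c := by positivity
  refine ⟨2 / κ * (C₀ * √(S + 4 ^ τ) + 2 * (C₀ * (c / (τ - 1))) * (C₀ * √S / κ)),
    by positivity, ?_⟩
  intro j hj Γ ν _ hmin hΓ hν
  have hj0 : (0 : ℝ) < j := by exact_mod_cast (by omega : 0 < j)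
  have hlog : 0 ≤ Real.log j := Real.log_natCast_nonneg j
  set r := ((Real.log j + 1) / j) ^ (τ - 1) with hr
  have hr0 : 0 < r := by positivity
  set a := 2 * (τ - 1) * ((Real.log j + 1) / j) with ha_def
  have ha : 0 < a := by positivity
  set x := Γ⁻¹ *ᵥ ν with hx
  have hΓx : Γ *ᵥ x = ν := mulVec_inv_mulVec_of_quadLB hκ hmin ν
  have hnorm : euclNorm x ≤ C₀ * √S / κ := by
    rw [le_div_iff₀' hκ]
    refine (mul_euclNorm_le_of_quadLB hmin x).trans ?_
    rw [hΓx]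
    exact euclNorm_le_of_decay hτ hC₀ hν
  have henergy := expWeight_energy_bound hτ hC₀ ha hδ hmin hΓ x
  rw [hΓx, ← hS, hδS, ← hε_def] at henergy
  have hrate : (ε / a) ^ (-(τ - 1)) = c * r := by
    rw [hc, hr, ← Real.mul_rpow (by positivity) (by positivity), Real.rpow_neg (by positivity),
      ← Real.inv_rpow (by positivity), inv_div, ha_def]
    congr 1
    ring
  rw [hrate] at henergy
  have hdata : euclNorm (expWeight a j * ν) ≤ C₀ * √(S + 4 ^ τ) * r := by
    have haj : 2 * (τ - 1) * Real.log j ≤ a * j := by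
      rw [ha_def, mul_assoc _ _ (j : ℝ), div_mul_cancel₀ _ hj0.ne']
      nlinarith
    refine (euclNorm_expWeight_mul_le hτ hC₀ (by omega) ha.le haj hν).trans ?_
    gcongr
    rw [hr, Real.rpow_neg hj0.le, ← Real.inv_rpow hj0.le]
    refine Real.rpow_le_rpow (by positivity) ?_ hτ'.le
    rw [inv_eq_one_div]
    gcongr
    linarith
  have hlast : |x ⟨j - 1, by omega⟩| ≤ euclNorm (expWeight a j * x) := by
    refine le_trans (le_of_eq ?_) (abs_le_euclNorm _ ⟨j - 1, by omega⟩)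
    rw [Pi.mul_apply, expWeight, Nat.cast_sub (by omega)]
    simp
  have hfar : 2 * (C₀ * (c * r / (τ - 1))) * euclNorm x ≤
      2 * (C₀ * (c * r / (τ - 1))) * (C₀ * √S / κ) := by gcongr
  refine hlast.trans ?_
  have hfinal : κ / 2 * euclNorm (expWeight a j * x) ≤
      (C₀ * √(S + 4 ^ τ) + 2 * (C₀ * (c / (τ - 1))) * (C₀ * √S / κ)) * r := by
    calc _ ≤ C₀ * √(S + 4 ^ τ) * r + 2 * (C₀ * (c * r / (τ - 1))) * (C₀ * √S / κ) := by
          linarith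
      _ = _ := by ring
  calc euclNorm (expWeight a j * x)
      = 2 / κ * (κ / 2 * euclNorm (expWeight a j * x)) := by field_simp
    _ ≤ 2 / κ * ((C₀ * √(S + 4 ^ τ) + 2 * (C₀ * (c / (τ - 1))) * (C₀ * √S / κ)) * r) := by
        gcongr
    _ = _ := by ring
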